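/- arXiv:1901.09967 — 8 statements merged into one kernel-verified Lean document; each statement's English description precedes it below -/
import Mathlib

section
/- Let n ≥ 1 be a natural number, let t1 < t2 be real numbers with Δt = t2 − t1, and let f : ℝ → ℝ be 2n-times continuously differentiable on [t1, t2]. Then there exists τ ∈ [t1, t2] such that ∫_{t1}^{t2} f(t) dt = Σ_{l=1}^{n} C_{l,n} (Δt^l / l!) [ f^{(l−1)}(t1) + (−1)^{l−1} f^{(l−1)}(t2) ] + (−1)^n (n!)² / ((2n+1)! (2n)!) · Δt^{2n+1} · f^{(2n)}(τ), where C_{l,n} = n! (2n−l)! / ((2n)! (n−l)!). (The Lanczos–Dyche integration formula with remainder.) -/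
open Polynomial in
/-- Repeated integration by parts of `F 0` against the `N`-th derivative of a polynomial, where
`F (j + 1)` is the derivative of `F j`. -/
theorem integral_mul_iterate_derivative_eval {a b : ℝ} (F : ℕ → ℝ → ℝ) (N : ℕ)
    (hcont : ∀ j ≤ N, ContinuousOn (F j) (Set.uIcc a b))
    (hderiv : ∀ j < N, ∀ x ∈ Set.uIcc a b,
      HasDerivWithinAt (F j) (F (j + 1) x) (Set.uIcc a b) x) (p : ℝ[X]) :
    ∫ x in a..b, F 0 x * (derivative^[N] p).eval x =
      (∑ j ∈ Finset.range N, (-1 : ℝ) ^ j *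
        (F j b * (derivative^[N - 1 - j] p).eval b -
          F j a * (derivative^[N - 1 - j] p).eval a)) +
      (-1 : ℝ) ^ N * ∫ x in a..b, F N x * p.eval x := by
  induction N generalizing p with
  | zero => simp
  | succ N ih =>
    have hparts : ∫ x in a..b, F N x * (derivative p).eval x =
        F N b * p.eval b - F N a * p.eval a - ∫ x in a..b, F (N + 1) x * p.eval x :=
      intervalIntegral.integral_mul_deriv_eq_deriv_mul_of_hasDerivWithinAt
        (hderiv N N.lt_succ_self) (fun x _ => (p.hasDerivAt x).hasDerivWithinAt)
        (hcont (N + 1) le_rfl).intervalIntegrable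
        ((derivative p).continuous.intervalIntegrable _ _)
    rw [Function.iterate_succ_apply,
      ih (fun j hj => hcont j (by omega)) (fun j hj => hderiv j (by omega)), hparts,
      Finset.sum_range_succ]
    have hsum : ∀ j ∈ Finset.range N, derivative^[N - 1 - j] (derivative p) =
        derivative^[N + 1 - 1 - j] p := by
      intro j hj
      rw [Finset.mem_range] at hj
      rw [← Function.iterate_succ_apply]
      congr 2
      omega
    rw [Finset.sum_congr rfl fun j hj => by rw [hsum j hj]]
    simp only [add_tsub_cancel_right, tsub_self, Function.iterate_zero, id_eq, pow_succ]
    ring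

theorem hasDerivAt_sub_pow_succ_div (a x : ℝ) (p : ℕ) :
    HasDerivAt (fun x => (x - a) ^ (p + 1) / (p + 1 : ℝ)) ((x - a) ^ p) x := by
  refine ((((hasDerivAt_id' x).sub_const a).fun_pow (p + 1)).div_const (p + 1 : ℝ)).congr_deriv ?_
  have : (p + 1 : ℝ) ≠ 0 := by positivity
  simp
  field_simp

/-- An Euler beta integral with natural exponents over an arbitrary interval. -/
theorem integral_sub_pow_mul_sub_pow (a b : ℝ) (p q : ℕ) :
    ∫ x in a..b, (x - a) ^ p * (b - x) ^ q =
      (p.factorial * q.factorial : ℝ) / (p + q + 1).factorial * (b - a) ^ (p + q + 1) := by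
  induction q generalizing p with
  | zero =>
    have h : ∀ x ∈ Set.uIcc a b,
        HasDerivAt (fun x => (x - a) ^ (p + 1) / (p + 1 : ℝ)) ((x - a) ^ p * (b - x) ^ 0) x := by
      intro x _
      simpa using hasDerivAt_sub_pow_succ_div a x p
    rw [intervalIntegral.integral_eq_sub_of_hasDerivAt h
      (Continuous.intervalIntegrable (by fun_prop) _ _)]
    have : (p + 1 : ℝ) ≠ 0 := by positivity
    have : (p.factorial : ℝ) ≠ 0 := by positivity
    simp [Nat.factorial_succ]
    field_simp
  | succ q ih =>
    have hu : ∀ x ∈ Set.uIcc a b,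
        HasDerivAt (fun x => (x - a) ^ (p + 1) / (p + 1 : ℝ)) ((x - a) ^ p) x :=
      fun x _ => hasDerivAt_sub_pow_succ_div a x p
    have hv : ∀ x ∈ Set.uIcc a b,
        HasDerivAt (fun x => (b - x) ^ (q + 1)) (-((q + 1 : ℝ) * (b - x) ^ q)) x := by
      intro x _
      refine (((hasDerivAt_id' x).const_sub b).fun_pow (q + 1)).congr_deriv ?_
      simp
    have h := intervalIntegral.integral_deriv_mul_eq_sub hu hv
      (Continuous.intervalIntegrable (by fun_prop) _ _)
      (Continuous.intervalIntegrable (by fun_prop) _ _)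
    have hrec : ∫ x in a..b, (x - a) ^ p * (b - x) ^ (q + 1) =
        (q + 1) / (p + 1) * ∫ x in a..b, (x - a) ^ (p + 1) * (b - x) ^ q := by
      rw [intervalIntegral.integral_add (Continuous.intervalIntegrable (by fun_prop) _ _)
        (Continuous.intervalIntegrable (by fun_prop) _ _)] at h
      have h2 : ∀ x : ℝ, (x - a) ^ (p + 1) / (p + 1 : ℝ) * -((q + 1 : ℝ) * (b - x) ^ q) =
          -((q + 1) / (p + 1)) * ((x - a) ^ (p + 1) * (b - x) ^ q) := fun x => by ring
      simp only [h2, intervalIntegral.integral_const_mul] at h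
      simp only [sub_self, ne_eq, Nat.succ_ne_zero, not_false_eq_true, zero_pow,
        mul_zero, zero_div, zero_mul] at h
      linarith
    rw [hrec, ih, show p + 1 + q + 1 = p + (q + 1) + 1 by ring]
    have : (p + 1 : ℝ) ≠ 0 := by positivity
    have : ((p + (q + 1) + 1).factorial : ℝ) ≠ 0 := by positivity
    rw [Nat.factorial_succ p, Nat.factorial_succ q]
    push_cast
    field_simp

open Polynomial in
theorem eval_iterate_derivative_eq_factorial_mul_coeff_taylor {R : Type*} [CommRing R]
    (p : R[X]) (r : R) (k : ℕ) :
    (derivative^[k] p).eval r = k.factorial * (taylor r p).coeff k := by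
  rw [taylor_coeff, ← factorial_smul_hasseDeriv]
  simp

open Polynomial in
theorem coeff_taylor_X_sub_C_pow_mul {R : Type*} [CommRing R] (a b : R) (m n k : ℕ) :
    (taylor a ((X - C a) ^ m * (X - C b) ^ n)).coeff k =
      if m ≤ k then (a - b) ^ (n - (k - m)) * (n.choose (k - m) : R) else 0 := by
  have h : taylor a ((X - C a) ^ m * (X - C b) ^ n) = X ^ m * (X + C (a - b)) ^ n := by
    simp [taylor_mul, add_sub_assoc]
  rw [h, coeff_X_pow_mul']
  simp [coeff_X_add_C_pow, -map_sub]

open Polynomial in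
/-- The derivatives of order at least `n` of `(X - a)^n (X - b)^n` at the root `a`. -/
theorem eval_iterate_derivative_X_sub_C_pow_mul (a b : ℝ) {n l : ℕ} (hl : l ≤ n) :
    (derivative^[2 * n - l] ((X - C a) ^ n * (X - C b) ^ n)).eval a =
      (n.factorial * (2 * n - l).factorial : ℝ) / (n - l).factorial *
        ((a - b) ^ l / l.factorial) := by
  rw [eval_iterate_derivative_eq_factorial_mul_coeff_taylor, coeff_taylor_X_sub_C_pow_mul,
    if_pos (by omega), show 2 * n - l - n = n - l by omega, show n - (n - l) = l by omega,
    Nat.choose_symm hl, Nat.cast_choose ℝ hl]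
  field_simp

open Polynomial in
theorem eval_iterate_derivative_X_sub_C_pow_mul_of_lt (a b : ℝ) {n k : ℕ} (hk : k < n) :
    (derivative^[k] ((X - C a) ^ n * (X - C b) ^ n)).eval a = 0 := by
  rw [eval_iterate_derivative_eq_factorial_mul_coeff_taylor, coeff_taylor_X_sub_C_pow_mul,
    if_neg (by omega), mul_zero]

open Polynomial in
theorem eval_iterate_derivative_two_mul_X_sub_C_pow_mul (a b x : ℝ) (n : ℕ) :
    (derivative^[2 * n] ((X - C a) ^ n * (X - C b) ^ n)).eval x = (2 * n).factorial := by
  have hm : ((X - C a) ^ n * (X - C b) ^ n).Monic :=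
    ((monic_X_sub_C a).pow n).mul ((monic_X_sub_C b).pow n)
  have hd : ((X - C a) ^ n * (X - C b) ^ n).natDegree = 2 * n := by
    rw [((monic_X_sub_C a).pow n).natDegree_mul ((monic_X_sub_C b).pow n)]
    simp [two_mul]
  rw [eval_iterate_derivative_eq_factorial_mul_coeff_taylor, ← hd, coeff_taylor_natDegree,
    hm.leadingCoeff, mul_one]

/-- The Lanczos–Dyche integration formula with remainder: if `f` is `2n`-times
continuously differentiable on `[t1, t2]` (with `n ≥ 1` and `t1 < t2`), then there
is `τ ∈ [t1, t2]` such that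
`∫_{t1}^{t2} f = Σ_{l=1}^n C_{l,n} (Δt^l/l!) [f^{(l-1)}(t1) + (-1)^{l-1} f^{(l-1)}(t2)]
  + (-1)^n (n!)²/((2n+1)!(2n)!) Δt^{2n+1} f^{(2n)}(τ)`,
where `C_{l,n} = n!(2n-l)!/((2n)!(n-l)!)`. -/
theorem lanczos_dyche_formula (n : ℕ) (hn : 1 ≤ n) (t1 t2 : ℝ) (h12 : t1 < t2)
    (f : ℝ → ℝ) (hf : ContDiffOn ℝ (2 * n) f (Set.Icc t1 t2)) :
    ∃ τ ∈ Set.Icc t1 t2,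
      ∫ t in t1..t2, f t =
        (∑ l ∈ Finset.Icc 1 n,
          ((Nat.factorial n * Nat.factorial (2 * n - l) : ℝ) /
              (Nat.factorial (2 * n) * Nat.factorial (n - l))) *
            ((t2 - t1) ^ l / Nat.factorial l) *
            (iteratedDerivWithin (l - 1) f (Set.Icc t1 t2) t1 +
              (-1 : ℝ) ^ (l - 1) * iteratedDerivWithin (l - 1) f (Set.Icc t1 t2) t2))
        + (-1 : ℝ) ^ n * (Nat.factorial n : ℝ) ^ 2 /
            (Nat.factorial (2 * n + 1) * Nat.factorial (2 * n)) *
            (t2 - t1) ^ (2 * n + 1) * iteratedDerivWithin (2 * n) f (Set.Icc t1 t2) τ := by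
  have hu : Set.uIcc t1 t2 = Set.Icc t1 t2 := Set.uIcc_of_le h12.le
  have hud : UniqueDiffOn ℝ (Set.Icc t1 t2) := uniqueDiffOn_Icc h12
  obtain ⟨hc, hd⟩ := (contDiffOn_nat_iff_continuousOn_differentiableOn_deriv (n := 2 * n) hud).1
    (by exact_mod_cast hf)
  obtain ⟨p, hp⟩ : ∃ p : Polynomial ℝ, p = (Polynomial.X - Polynomial.C t1) ^ n *
    (Polynomial.X - Polynomial.C t2) ^ n := ⟨_, rfl⟩
  have hp' : p = (Polynomial.X - Polynomial.C t2) ^ n * (Polynomial.X - Polynomial.C t1) ^ n := by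
    rw [hp, mul_comm]
  have hparts := integral_mul_iterate_derivative_eval (a := t1) (b := t2)
    (fun j => iteratedDerivWithin j f (Set.Icc t1 t2)) (2 * n)
    (fun j hj => by rw [hu]; exact hc j hj)
    (fun j hj x hx => by
      rw [hu] at hx ⊢
      simp only [iteratedDerivWithin_succ]
      exact (hd j hj x hx).hasDerivWithinAt) p
  have hleft : ∫ x in t1..t2, iteratedDerivWithin 0 f (Set.Icc t1 t2) x *
      (Polynomial.derivative^[2 * n] p).eval x = (2 * n).factorial * ∫ x in t1..t2, f x := by
    simp only [hp, eval_iterate_derivative_two_mul_X_sub_C_pow_mul, iteratedDerivWithin_zero,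
      intervalIntegral.integral_mul_const]
    ring
  obtain ⟨τ, hτ, hmean⟩ := exists_eq_const_mul_intervalIntegral_of_nonneg
    (μ := MeasureTheory.volume) (a := t1) (b := t2)
    (f := iteratedDerivWithin (2 * n) f (Set.Icc t1 t2)) (g := fun x => (x - t1) ^ n * (t2 - x) ^ n)
    (by rw [hu]; exact hc _ le_rfl)
    (Continuous.intervalIntegrable (by fun_prop) _ _)
    (fun x hx => by
      rw [Set.uIoc_of_le h12.le] at hx
      have h1 : 0 ≤ x - t1 := by linarith [hx.1]
      have h2 : 0 ≤ t2 - x := by linarith [hx.2]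
      positivity)
  have hrem : ∫ x in t1..t2, iteratedDerivWithin (2 * n) f (Set.Icc t1 t2) x * p.eval x =
      (-1 : ℝ) ^ n * (iteratedDerivWithin (2 * n) f (Set.Icc t1 t2) τ *
        ((n.factorial * n.factorial : ℝ) / (n + n + 1).factorial *
          (t2 - t1) ^ (n + n + 1))) := by
    rw [← integral_sub_pow_mul_sub_pow, ← hmean, ← intervalIntegral.integral_const_mul]
    refine intervalIntegral.integral_congr fun x _ => ?_
    have : (x - t2) ^ n = (-1 : ℝ) ^ n * (t2 - x) ^ n := by
      rw [← mul_pow]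
      ring
    simp only [hp, Polynomial.eval_mul, Polynomial.eval_pow, Polynomial.eval_sub,
      Polynomial.eval_X, Polynomial.eval_C, this]
    ring
  have hsum : ∑ j ∈ Finset.range (2 * n), (-1 : ℝ) ^ j *
        (iteratedDerivWithin j f (Set.Icc t1 t2) t2 *
            (Polynomial.derivative^[2 * n - 1 - j] p).eval t2 -
          iteratedDerivWithin j f (Set.Icc t1 t2) t1 *
            (Polynomial.derivative^[2 * n - 1 - j] p).eval t1) =
      (2 * n).factorial * ∑ l ∈ Finset.Icc 1 n,
        ((Nat.factorial n * Nat.factorial (2 * n - l) : ℝ) /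
            (Nat.factorial (2 * n) * Nat.factorial (n - l))) *
          ((t2 - t1) ^ l / Nat.factorial l) *
          (iteratedDerivWithin (l - 1) f (Set.Icc t1 t2) t1 +
            (-1 : ℝ) ^ (l - 1) * iteratedDerivWithin (l - 1) f (Set.Icc t1 t2) t2) := by
    rw [two_mul n, Finset.sum_range_add, ← two_mul, Finset.sum_eq_zero (s := Finset.range n)
      (f := fun j => (-1 : ℝ) ^ (n + j) * _), add_zero]
    · rw [← Finset.Ico_add_one_right_eq_Icc, Finset.sum_Ico_eq_sum_range, Finset.mul_sum]
      refine Finset.sum_congr (by simp) fun j hj => ?_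
      rw [Finset.mem_range] at hj
      have hneg : (t1 - t2) ^ (1 + j) = (-1 : ℝ) ^ (1 + j) * (t2 - t1) ^ (1 + j) := by
        rw [← mul_pow]
        ring
      have hsq : ((-1 : ℝ) ^ j) * (-1) ^ j = 1 := by
        rw [← mul_pow]
        simp
      rw [Nat.sub_sub, hp, eval_iterate_derivative_X_sub_C_pow_mul t1 t2 (by omega), ← hp, hp',
        eval_iterate_derivative_X_sub_C_pow_mul t2 t1 (by omega), hneg, add_tsub_cancel_left]
      have h2n : ((2 * n).factorial : ℝ) ≠ 0 := by positivity
      field_simp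
      linear_combination (iteratedDerivWithin j f (Set.Icc t1 t2) t1 * (t2 - t1) ^ (1 + j)) * hsq
    · intro j hj
      rw [Finset.mem_range] at hj
      rw [hp, eval_iterate_derivative_X_sub_C_pow_mul_of_lt t1 t2 (by omega), ← hp, hp',
        eval_iterate_derivative_X_sub_C_pow_mul_of_lt t2 t1 (by omega)]
      ring
  refine ⟨τ, hu ▸ hτ, ?_⟩
  rw [hleft, hsum, hrem, ← two_mul] at hparts
  have h2n : ((2 * n).factorial : ℝ) ≠ 0 := by positivity
  refine mul_left_cancel₀ h2n (hparts.trans ?_)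
  rw [mul_add, (even_two_mul n).neg_one_pow]
  field_simp
end

section
/- Let t1 < t2 be real numbers with Δt = t2 − t1, and let f : ℝ → ℝ be 4-times continuously differentiable on [t1, t2]. Then there exists τ ∈ [t1, t2] such that ∫_{t1}^{t2} f(t) dt = (Δt/2)(f(t1) + f(t2)) + (Δt²/12)(f'(t1) − f'(t2)) + (Δt⁵/720) f⁗(τ). (Hermite's fourth-order integration rule with remainder.) -/
open Set in
/-- The iterated derivatives of a function that is `n` times continuously differentiable on
`[a, b]` differentiate into each other in the interior. -/
lemma ContDiffOn.hasDerivAt_iteratedDerivWithin_Icc {a b x : ℝ} {f : ℝ → ℝ} {n : WithTop ℕ∞}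
    (hf : ContDiffOn ℝ n f (Icc a b)) {k : ℕ} (hk : (k : WithTop ℕ∞) < n) (hx : x ∈ Ioo a b) :
    HasDerivAt (iteratedDerivWithin k f (Icc a b)) (iteratedDerivWithin (k + 1) f (Icc a b) x) x := by
  have hs : UniqueDiffOn ℝ (Icc a b) := uniqueDiffOn_Icc (hx.1.trans hx.2)
  have h := (hf.differentiableOn_iteratedDerivWithin hk hs x
    (Ioo_subset_Icc_self hx)).hasDerivWithinAt
  rw [← iteratedDerivWithin_succ] at h
  exact h.hasDerivAt (Icc_mem_nhds hx.1 hx.2)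

/-- Hermite's fourth-order integration rule with remainder: if `f` is 4-times
continuously differentiable on `[t1, t2]` with `t1 < t2`, then there is
`τ ∈ [t1, t2]` with
`∫_{t1}^{t2} f = (Δt/2)(f(t1)+f(t2)) + (Δt²/12)(f'(t1)-f'(t2)) + (Δt⁵/720) f⁗(τ)`. -/
theorem hermite_rule (t1 t2 : ℝ) (h12 : t1 < t2)
    (f : ℝ → ℝ) (hf : ContDiffOn ℝ 4 f (Set.Icc t1 t2)) :
    ∃ τ ∈ Set.Icc t1 t2,
      ∫ t in t1..t2, f t =
        (t2 - t1) / 2 * (f t1 + f t2)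
        + (t2 - t1) ^ 2 / 12 *
            (iteratedDerivWithin 1 f (Set.Icc t1 t2) t1 -
              iteratedDerivWithin 1 f (Set.Icc t1 t2) t2)
        + (t2 - t1) ^ 5 / 720 * iteratedDerivWithin 4 f (Set.Icc t1 t2) τ := by
  have hs : UniqueDiffOn ℝ (Set.Icc t1 t2) := uniqueDiffOn_Icc h12
  have hfc : ContinuousOn f (Set.Icc t1 t2) := hf.continuousOn
  have hint : IntervalIntegrable f MeasureTheory.volume t1 t2 :=
    hfc.intervalIntegrable_of_Icc h12.le
  set D : ℕ → ℝ → ℝ := fun k => iteratedDerivWithin k f (Set.Icc t1 t2)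
  have hDc : ∀ k : ℕ, (k : WithTop ℕ∞) ≤ 4 → ContinuousOn (D k) (Set.Icc t1 t2) :=
    fun k hk => hf.continuousOn_iteratedDerivWithin hk hs
  have hDd : ∀ k : ℕ, (k : WithTop ℕ∞) < 4 → ∀ x ∈ Set.Ioo t1 t2,
      HasDerivAt (D k) (D (k + 1) x) x :=
    fun k hk x hx => hf.hasDerivAt_iteratedDerivWithin_Icc hk hx
  have hD0 : D 0 = f := iteratedDerivWithin_zero
  have hFc : ContinuousOn (fun x => ∫ t in t1..x, f t) (Set.Icc t1 t2) := by
    have := intervalIntegral.continuousOn_primitive_interval' hint Set.left_mem_uIcc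
    rwa [Set.uIcc_of_le h12.le] at this
  have hFd : ∀ x ∈ Set.Ioo t1 t2, HasDerivAt (fun x => ∫ t in t1..x, f t) (f x) x := by
    intro x hx
    refine intervalIntegral.integral_hasDerivAt_right
      (hint.mono_set ?_) ?_ (hfc.continuousAt (Icc_mem_nhds hx.1 hx.2))
    · rw [Set.uIcc_of_le hx.1.le, Set.uIcc_of_le h12.le]
      exact Set.Icc_subset_Icc_right hx.2.le
    · exact (hfc.mono Set.Ioo_subset_Icc_self).stronglyMeasurableAtFilter isOpen_Ioo x hx
  have hc1 := hDc 1 (by norm_num)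
  have hc2 := hDc 2 (by norm_num)
  have hc3 := hDc 3 (by norm_num)
  obtain ⟨c, hc, h⟩ := exists_ratio_hasDerivAt_eq_ratio_slope
    (fun x => (x - t1) ^ 2 * (x - t2) ^ 2 / 24 * D 3 x
      - (x - t1) * (x - t2) * (2 * x - t1 - t2) / 12 * D 2 x
      + ((x - t1) ^ 2 + 4 * (x - t1) * (x - t2) + (x - t2) ^ 2) / 12 * D 1 x
      - (2 * x - t1 - t2) / 2 * f x + ∫ t in t1..x, f t)
    (fun x => (x - t1) ^ 2 * (x - t2) ^ 2 / 24 * D 4 x) h12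
    (by fun_prop)
    (by
      intro x hx
      have h0 := hDd 0 (by norm_num) x hx
      rw [hD0] at h0
      have h1 := hDd 1 (by norm_num) x hx
      have h2 := hDd 2 (by norm_num) x hx
      have h3 := hDd 3 (by norm_num) x hx
      have u := (hasDerivAt_id' x).sub_const t1
      have v := (hasDerivAt_id' x).sub_const t2
      have w := (((hasDerivAt_id' x).const_mul 2).sub_const t1).sub_const t2
      have := ((((((((u.pow 2).mul (v.pow 2)).div_const 24).mul h3).sub
        ((((u.mul v).mul w).div_const 12).mul h2)).add
        (((((u.pow 2).add ((u.const_mul 4).mul v)).add (v.pow 2)).div_const 12).mul h1)).sub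
        ((w.div_const 2).mul h0)).add (hFd x hx))
      refine this.congr_deriv ?_
      simp only [Pi.mul_apply, Pi.pow_apply, Pi.add_apply]
      push_cast
      ring)
    (fun x => ((x - t1) ^ 5 / 5 - (t2 - t1) * (x - t1) ^ 4 / 2
      + (t2 - t1) ^ 2 * (x - t1) ^ 3 / 3) / 24)
    (fun x => (x - t1) ^ 2 * (x - t2) ^ 2 / 24)
    (by fun_prop)
    (by
      intro x _
      have u := (hasDerivAt_id' x).sub_const t1
      have := ((((u.pow 5).div_const 5).sub (((u.pow 4).const_mul (t2 - t1)).div_const 2)).add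
        (((u.pow 3).const_mul ((t2 - t1) ^ 2)).div_const 3)).div_const 24
      refine this.congr_deriv ?_
      push_cast
      ring)
  refine ⟨c, Set.Ioo_subset_Icc_self hc, ?_⟩
  have hK : (c - t1) ^ 2 * (c - t2) ^ 2 / 24 ≠ 0 := by
    have := sub_ne_zero.2 hc.1.ne'
    have := sub_ne_zero.2 hc.2.ne
    positivity
  refine mul_right_cancel₀ hK ?_
  simp only [intervalIntegral.integral_same] at h
  change _ = ((t2 - t1) / 2 * (f t1 + f t2) + (t2 - t1) ^ 2 / 12 * (D 1 t1 - D 1 t2)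
    + (t2 - t1) ^ 5 / 720 * D 4 c) * _
  linear_combination -h
end

section
/- Let n ≥ 1 be a natural number, let t1 < t2 be real numbers, and let f : ℝ → ℝ be 2n-times continuously differentiable on [t1, t2]. Let P be a polynomial with real coefficients of degree at most 2n−1 whose derivatives of order j satisfy P^{(j)}(t1) = f^{(j)}(t1) and P^{(j)}(t2) = f^{(j)}(t2) for all 0 ≤ j ≤ n−1 (the two-point Hermite interpolant). Then for every t ∈ (t1, t2) there exists τ ∈ (t1, t2) such that f(t) − P(t) = ((t−t1)(t−t2))^n / (2n)! · f^{(2n)}(τ). (Remainder of the two-point Taylor/Hermite interpolation.) -/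
/-- Rolle's theorem for several zeros: between `m + 1` zeros of a function there are `m` zeros of
its derivative. -/
theorem exists_finset_zeros_deriv {a b : ℝ} {g g' : ℝ → ℝ} (hg : ContinuousOn g (Set.Icc a b))
    (hg' : ∀ x ∈ Set.Ioo a b, HasDerivAt g (g' x) x) {S : Finset ℝ}
    (hS : ∀ x ∈ S, x ∈ Set.Icc a b ∧ g x = 0) {m : ℕ} (hm : S.card = m + 1) :
    ∃ T : Finset ℝ, T.card = m ∧ ∀ x ∈ T, x ∈ Set.Ioo a b ∧ g' x = 0 := by
  by_cases hfin : {x | x ∈ Set.Ioo a b ∧ g' x = 0}.Finite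
  · have hle : S.card ≤ hfin.toFinset.card + 1 := by
      refine Finset.card_le_of_interleaved fun x hx y hy hxy _ => ?_
      obtain ⟨⟨hax, -⟩, hgx⟩ := hS x hx
      obtain ⟨⟨-, hyb⟩, hgy⟩ := hS y hy
      obtain ⟨z, hz, hgz⟩ := exists_hasDerivAt_eq_zero hxy
        (hg.mono (Set.Icc_subset_Icc hax hyb)) (hgx.trans hgy.symm)
        (fun z hz => hg' z (Set.Ioo_subset_Ioo hax hyb hz))
      exact ⟨z, by simpa using ⟨Set.Ioo_subset_Ioo hax hyb hz, hgz⟩, hz.1, hz.2⟩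
    obtain ⟨T, hT, hcard⟩ := Finset.exists_subset_card_eq (show m ≤ hfin.toFinset.card by omega)
    exact ⟨T, hcard, fun x hx => by simpa using hT hx⟩
  · obtain ⟨T, hT, hcard⟩ := Set.Infinite.exists_subset_card_eq hfin m
    exact ⟨T, hcard, fun x hx => hT hx⟩

/-- A function vanishing at an interior point and, together with its first `n - 1` derivatives,
at both endpoints has a `2n`-th derivative with an interior zero. -/
theorem exists_zero_of_two_point_zeros {a b t : ℝ} (ht : t ∈ Set.Ioo a b) {n : ℕ}
    {g : ℕ → ℝ → ℝ} (hg : ∀ k < 2 * n, ContinuousOn (g k) (Set.Icc a b))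
    (hg' : ∀ k < 2 * n, ∀ x ∈ Set.Ioo a b, HasDerivAt (g k) (g (k + 1) x) x)
    (ha : ∀ k < n, g k a = 0) (hb : ∀ k < n, g k b = 0) (hgt : g 0 t = 0) :
    ∃ τ ∈ Set.Ioo a b, g (2 * n) τ = 0 := by
  have hab : a < b := ht.1.trans ht.2
  have hzeros : ∀ k ≤ 2 * n, ∃ S : Finset ℝ, S.card = min (k + 1) (2 * n + 1 - k) ∧
      ∀ x ∈ S, x ∈ Set.Ioo a b ∧ g k x = 0 := by
    intro k
    induction k with
    | zero =>
      intro _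
      exact ⟨{t}, by simp, by simpa using ⟨ht, hgt⟩⟩
    | succ k ih =>
      intro hk
      obtain ⟨S, hcard, hS⟩ := ih (by omega)
      have hS' : ∀ x ∈ S, x ∈ Set.Icc a b ∧ g k x = 0 :=
        fun x hx => ⟨Set.Ioo_subset_Icc_self (hS x hx).1, (hS x hx).2⟩
      by_cases hkn : k < n
      · have hbS : b ∉ S := fun h => lt_irrefl _ (hS b h).1.2
        have haS : a ∉ insert b S := by
          simpa [hab.ne] using fun h => lt_irrefl _ (hS a h).1.1
        refine exists_finset_zeros_deriv (S := insert a (insert b S)) (hg k (by omega))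
          (hg' k (by omega)) ?_ ?_
        · intro x hx
          rcases Finset.mem_insert.1 hx with rfl | hx
          · exact ⟨Set.left_mem_Icc.2 hab.le, ha k hkn⟩
          rcases Finset.mem_insert.1 hx with rfl | hx
          · exact ⟨Set.right_mem_Icc.2 hab.le, hb k hkn⟩
          · exact hS' x hx
        · rw [Finset.card_insert_of_notMem haS, Finset.card_insert_of_notMem hbS, hcard]
          omega
      · exact exists_finset_zeros_deriv (hg k (by omega)) (hg' k (by omega)) hS' (by omega)
  obtain ⟨S, hcard, hS⟩ := hzeros (2 * n) le_rfl
  obtain ⟨τ, hτ⟩ := Finset.card_pos.1 (show 0 < S.card by omega)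
  exact ⟨τ, hS τ hτ⟩

namespace Polynomial

theorem eval_iterate_derivative_eq_zero_of_pow_dvd {R : Type*} [CommRing R]
    {p : Polynomial R} {c : R} {n j : ℕ} (h : (X - C c) ^ n ∣ p) (hj : j < n) :
    (derivative^[j] p).eval c = 0 :=
  dvd_iff_isRoot.1 ((dvd_pow_self _ (by omega)).trans
    (pow_sub_dvd_iterate_derivative_of_pow_dvd j h))

theorem Monic.iterate_derivative_natDegree {R : Type*} [CommRing R]
    {p : Polynomial R} (hp : p.Monic) :
    derivative^[p.natDegree] p = C (p.natDegree.factorial : R) := by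
  rw [eq_C_of_natDegree_le_zero ((natDegree_iterate_derivative p _).trans_eq (Nat.sub_self _)),
    coeff_iterate_derivative, zero_add, Nat.descFactorial_self, hp.coeff_natDegree, nsmul_one]

end Polynomial

open Polynomial

/-- Remainder of two-point Taylor / Hermite interpolation: if `f` is `2n`-times
continuously differentiable on `[t1, t2]` and `P` is the polynomial of degree
`≤ 2n-1` matching the values and first `n-1` derivatives of `f` at `t1` and `t2`,
then for every `t ∈ (t1, t2)` there is `τ ∈ (t1, t2)` with
`f(t) - P(t) = ((t-t1)(t-t2))^n / (2n)! · f^{(2n)}(τ)`. -/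
theorem two_point_taylor_remainder (n : ℕ) (hn : 1 ≤ n) (t1 t2 : ℝ) (h12 : t1 < t2)
    (f : ℝ → ℝ) (hf : ContDiffOn ℝ (2 * n) f (Set.Icc t1 t2))
    (P : Polynomial ℝ) (hdeg : P.degree ≤ (2 * n - 1 : ℕ))
    (h1 : ∀ j < n, (Polynomial.derivative^[j] P).eval t1 =
      iteratedDerivWithin j f (Set.Icc t1 t2) t1)
    (h2 : ∀ j < n, (Polynomial.derivative^[j] P).eval t2 =
      iteratedDerivWithin j f (Set.Icc t1 t2) t2) :
    ∀ t ∈ Set.Ioo t1 t2, ∃ τ ∈ Set.Ioo t1 t2,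
      f t - P.eval t =
        ((t - t1) * (t - t2)) ^ n / Nat.factorial (2 * n) *
          iteratedDerivWithin (2 * n) f (Set.Icc t1 t2) τ := by
  intro t ht
  set s := Set.Icc t1 t2
  have hsu : UniqueDiffOn ℝ s := uniqueDiffOn_Icc h12
  have hne : ((t - t1) * (t - t2)) ^ n ≠ 0 :=
    pow_ne_zero _ (mul_ne_zero (sub_ne_zero.2 ht.1.ne') (sub_ne_zero.2 ht.2.ne))
  set W : Polynomial ℝ := ((X - C t1) * (X - C t2)) ^ n with hW
  have hWmonic : W.Monic := ((monic_X_sub_C t1).mul (monic_X_sub_C t2)).pow n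
  have hWdeg : W.natDegree = 2 * n := by
    rw [hW, ((monic_X_sub_C t1).mul (monic_X_sub_C t2)).natDegree_pow,
      (monic_X_sub_C t1).natDegree_mul (monic_X_sub_C t2)]
    simp [mul_comm]
  have hW1 : (X - C t1) ^ n ∣ W := pow_dvd_pow_of_dvd (dvd_mul_right _ _) n
  have hW2 : (X - C t2) ^ n ∣ W := pow_dvd_pow_of_dvd (dvd_mul_left _ _) n
  set K : ℝ := (f t - P.eval t) / ((t - t1) * (t - t2)) ^ n with hK
  have hQ (k : ℕ) (x : ℝ) : (derivative^[k] (P + C K * W)).eval x =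
      (derivative^[k] P).eval x + K * (derivative^[k] W).eval x := by
    simp [iterate_derivative_C_mul]
  have hdiff : ∀ k < 2 * n, DifferentiableOn ℝ (iteratedDerivWithin k f s) s := fun k hk =>
    hf.differentiableOn_iteratedDerivWithin (by exact_mod_cast hk) hsu
  obtain ⟨τ, hτ, hzero⟩ := exists_zero_of_two_point_zeros ht (n := n)
    (g := fun k x => iteratedDerivWithin k f s x - (derivative^[k] (P + C K * W)).eval x)
    (fun k hk => (hdiff k hk).continuousOn.sub (Polynomial.continuousOn _))
    (fun k hk x hx => by
      have hmem : s ∈ nhds x := Icc_mem_nhds hx.1 hx.2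
      have hder := ((hdiff k hk x (Set.Ioo_subset_Icc_self hx)).hasDerivWithinAt).hasDerivAt hmem
      rw [← iteratedDerivWithin_succ] at hder
      simpa only [Function.iterate_succ_apply'] using hder.fun_sub (Polynomial.hasDerivAt _ x))
    (fun k hk => by
      simp only [hQ, h1 k hk, eval_iterate_derivative_eq_zero_of_pow_dvd hW1 hk]; ring)
    (fun k hk => by
      simp only [hQ, h2 k hk, eval_iterate_derivative_eq_zero_of_pow_dvd hW2 hk]; ring)
    (by
      have hWt : W.eval t = ((t - t1) * (t - t2)) ^ n := by simp [hW]
      simp only [iteratedDerivWithin_zero, Function.iterate_zero, id, eval_add, eval_mul, eval_C,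
        hWt, hK, div_mul_cancel₀ _ hne]
      ring)
  refine ⟨τ, hτ, ?_⟩
  have hP : derivative^[2 * n] P = 0 := iterate_derivative_eq_zero_of_degree_lt
    (hdeg.trans_lt (by exact_mod_cast (by omega : 2 * n - 1 < 2 * n)))
  have hWn : derivative^[2 * n] W = C ((2 * n).factorial : ℝ) := by
    simpa only [hWdeg] using hWmonic.iterate_derivative_natDegree
  simp only [hQ, hP, hWn, eval_zero, eval_C, zero_add] at hzero
  have hfac : ((2 * n).factorial : ℝ) ≠ 0 := by positivity
  rw [sub_eq_zero.1 hzero, hK]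
  field_simp
end

section
/- Let n ≥ 1 be a natural number and t1, t2 real numbers with Δt = t2 − t1. For every polynomial P with real coefficients of degree at most 2n−1, the Lanczos–Dyche formula is exact: ∫_{t1}^{t2} P(t) dt = Σ_{l=1}^{n} C_{l,n} (Δt^l / l!) [ P^{(l−1)}(t1) + (−1)^{l−1} P^{(l−1)}(t2) ], where C_{l,n} = n! (2n−l)! / ((2n)! (n−l)!). -/
open Polynomial in
/-- The derivative of the boundary terms produced by integrating `derivative^[m] K * P` by parts
`m` times. -/
theorem derivative_sum_neg_one_pow_iterate_derivative_mul {R : Type*} [CommRing R]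
    (m : ℕ) (K P : R[X]) :
    derivative (∑ i ∈ Finset.range m,
        (-1) ^ i * (derivative^[m - 1 - i] K * derivative^[i] P)) =
      derivative^[m] K * P - (-1) ^ m * (K * derivative^[m] P) := by
  have h := Finset.sum_range_sub'
    (fun i => (-1 : R[X]) ^ i * (derivative^[m - i] K * derivative^[i] P)) m
  simp only [pow_zero, one_mul, Nat.sub_zero, Nat.sub_self, Function.iterate_zero, id] at h
  rw [← h, derivative_sum]
  refine Finset.sum_congr rfl fun i hi => ?_
  have hi' : i < m := Finset.mem_range.mp hi
  have hK : derivative (derivative^[m - 1 - i] K) = derivative^[m - i] K := by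
    rw [← Function.iterate_succ_apply' derivative]
    congr 2
    omega
  have hc : derivative ((-1 : R[X]) ^ i) = 0 := by
    simpa using derivative_C (a := (-1 : R) ^ i)
  rw [derivative_mul, derivative_mul, hc, hK, ← Function.iterate_succ_apply' derivative,
    show m - (i + 1) = m - 1 - i by omega]
  ring

open Polynomial in
/-- The iterated derivatives of `(X - a) ^ n * (X - b) ^ n` at the root `a`. -/
theorem eval_iterate_derivative_X_sub_C_pow_mul_X_sub_C_pow {R : Type*} [CommRing R]
    (n k : ℕ) (a b : R) :
    (derivative^[k] ((X - C a) ^ n * (X - C b) ^ n)).eval a =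
      if n ≤ k then k.factorial * ((a - b) ^ (n - (k - n)) * n.choose (k - n)) else 0 := by
  have ht : taylor a ((X - C a) ^ n * (X - C b) ^ n) = X ^ n * (X + C (a - b)) ^ n := by
    simp [taylor_mul, taylor_pow, add_sub_assoc]
  have hd := congrArg (fun f => f ((X - C a) ^ n * (X - C b) ^ n))
    (factorial_smul_hasseDeriv (R := R) k)
  simp only [LinearMap.smul_apply] at hd
  rw [← hd, eval_smul, ← taylor_coeff, ht, coeff_X_pow_mul', nsmul_eq_mul]
  split_ifs
  · rw [coeff_X_add_C_pow]
  · simp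

/-- Exactness of the Lanczos–Dyche formula on polynomials of degree at most `2n-1`:
`∫_{t1}^{t2} P = Σ_{l=1}^n C_{l,n} (Δt^l/l!) [P^{(l-1)}(t1) + (-1)^{l-1} P^{(l-1)}(t2)]`
with `C_{l,n} = n!(2n-l)!/((2n)!(n-l)!)`. -/
theorem lanczos_dyche_exact_on_polynomials (n : ℕ) (hn : 1 ≤ n) (t1 t2 : ℝ)
    (P : Polynomial ℝ) (hdeg : P.degree ≤ (2 * n - 1 : ℕ)) :
    ∫ t in t1..t2, P.eval t =
      ∑ l ∈ Finset.Icc 1 n,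
        ((Nat.factorial n * Nat.factorial (2 * n - l) : ℝ) /
            (Nat.factorial (2 * n) * Nat.factorial (n - l))) *
          ((t2 - t1) ^ l / Nat.factorial l) *
          ((Polynomial.derivative^[l - 1] P).eval t1 +
            (-1 : ℝ) ^ (l - 1) * (Polynomial.derivative^[l - 1] P).eval t2) := by
  open Polynomial in
  set K : ℝ[X] := (X - C t1) ^ n * (X - C t2) ^ n with hK
  set F : ℝ[X] := ∑ i ∈ Finset.range (2 * n),
    (-1) ^ i * (derivative^[2 * n - 1 - i] K * derivative^[i] P) with hF
  have hP : derivative^[2 * n] P = 0 := by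
    refine iterate_derivative_eq_zero ?_
    have := natDegree_le_of_degree_le hdeg
    omega
  have hKm : K.Monic := ((monic_X_sub_C t1).pow n).mul ((monic_X_sub_C t2).pow n)
  have hKdeg : K.natDegree = 2 * n := by
    rw [hK, ((monic_X_sub_C t1).pow n).natDegree_mul ((monic_X_sub_C t2).pow n)]
    simp
    ring
  have hKd : derivative^[2 * n] K = C ((2 * n).factorial : ℝ) := by
    have h0 := natDegree_iterate_derivative K (2 * n)
    rw [eq_C_of_natDegree_le_zero (h0.trans (by omega)), coeff_iterate_derivative, zero_add,
      ← hKdeg, hKm.coeff_natDegree, Nat.descFactorial_self, nsmul_one]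
  have hF' : derivative F = C ((2 * n).factorial : ℝ) * P := by
    rw [hF, derivative_sum_neg_one_pow_iterate_derivative_mul, hP, hKd]
    simp
  have hint : (2 * n).factorial * ∫ t in t1..t2, P.eval t = F.eval t2 - F.eval t1 := by
    rw [← intervalIntegral.integral_const_mul]
    refine intervalIntegral.integral_eq_sub_of_hasDerivAt (f := fun x => F.eval x)
      (fun x _ => ?_) ((P.continuous.intervalIntegrable _ _).const_mul _)
    simpa [hF'] using F.hasDerivAt x
  have hcoef : ∀ a b : ℝ, K = (X - C a) ^ n * (X - C b) ^ n →
      F.eval a = ∑ i ∈ Finset.range n, (-1) ^ i * (((2 * n - 1 - i).factorial *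
        ((a - b) ^ (i + 1) * n.choose (i + 1))) * (derivative^[i] P).eval a) := by
    intro a b hab
    rw [hF, eval_finsetSum, ← Finset.sum_subset (Finset.range_subset_range.mpr
      (show n ≤ 2 * n by omega))]
    · refine Finset.sum_congr rfl fun i hi => ?_
      have hi := Finset.mem_range.mp hi
      rw [hab]
      simp only [eval_mul, eval_pow, eval_neg, eval_one,
        eval_iterate_derivative_X_sub_C_pow_mul_X_sub_C_pow]
      rw [if_pos (by omega), show n - (2 * n - 1 - i - n) = i + 1 by omega,
        ← Nat.choose_symm (show i + 1 ≤ n by omega),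
        show 2 * n - 1 - i - n = n - (i + 1) by omega]
    · intro i _ hi
      have hi := mt Finset.mem_range.mpr hi
      rw [hab, eval_mul, eval_mul, eval_iterate_derivative_X_sub_C_pow_mul_X_sub_C_pow,
        if_neg (by omega)]
      simp
  have hfac : ((2 * n).factorial : ℝ) ≠ 0 := by positivity
  refine mul_left_cancel₀ hfac ?_
  rw [hint, hcoef t1 t2 rfl, hcoef t2 t1 (mul_comm _ _), ← Finset.sum_sub_distrib,
    Finset.mul_sum, Finset.range_eq_Ico, ← Finset.Ico_add_one_right_eq_Icc,
    Finset.sum_Ico_eq_sum_range, Finset.sum_Ico_eq_sum_range]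
  refine Finset.sum_congr rfl fun i hi => ?_
  have hi : i < n := by simpa using hi
  rw [Nat.cast_choose ℝ (show 0 + i + 1 ≤ n by omega), ← neg_sub t2 t1, neg_pow (t2 - t1),
    zero_add, add_comm 1 i, Nat.add_sub_cancel, show 2 * n - 1 - i = 2 * n - (i + 1) by omega]
  have hs : ((-1 : ℝ) ^ i) ^ 2 = 1 := by rw [← pow_mul, mul_comm, pow_mul]; simp
  field_simp
  rw [pow_succ (-1 : ℝ) i]
  linear_combination (t2 - t1) ^ (i + 1) * (derivative^[i] P).eval t1 * hs
end

section
/- For a natural number n, define the polynomial Q_n(μ) = Σ_{l=0}^{n} C_{l,n} μ^l / l! with C_{l,n} = n! (2n−l)! / ((2n)! (n−l)!). Then the function g : ℂ → ℂ given by g(μ) = e^{μ} · Q_n(−μ) − Q_n(μ) vanishes to order 2n+1 at μ = 0; that is, the k-th derivative of g at 0 equals 0 for every 0 ≤ k ≤ 2n. (Equivalently, Q_n(μ)/Q_n(−μ) is the diagonal (n,n) Padé approximant of the exponential: it agrees with e^{μ} to order μ^{2n} at μ = 0.) -/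
/-- The `k`-th finite difference of a binomial coefficient in its upper argument. -/
theorem alternating_sum_choose_mul_choose_sub (k n p : ℕ) (hk : k ≤ n + p) :
    ∑ l ∈ Finset.range (k + 1), (-1 : ℤ) ^ l * k.choose l * (n + p - l).choose n =
      (n + p - k).choose p := by
  induction k generalizing n with
  | zero => simp [Nat.choose_symm_add]
  | succ k ih =>
    cases n with
    | zero =>
      have hlt : 0 + p - (k + 1) < p := by omega
      simp only [Nat.choose_zero_right, Nat.cast_one, mul_one, Nat.choose_eq_zero_of_lt hlt]
      exact_mod_cast Int.alternating_sum_range_choose_of_ne k.succ_ne_zero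
    | succ n =>
      have hpascal : ∀ l ∈ Finset.range (k + 1),
          (-1 : ℤ) ^ l * k.choose l * (n + p - l).choose n =
            (-1 : ℤ) ^ l * k.choose l * (n + 1 + p - l).choose (n + 1) -
              (-1 : ℤ) ^ l * k.choose l * (n + p - l).choose (n + 1) := by
        intro l hl
        have hl' : l ≤ k := by simpa [Nat.lt_succ_iff] using hl
        rw [show n + 1 + p - l = (n + p - l) + 1 by omega, Nat.choose_succ_succ]
        push_cast
        ring
      rw [show n + 1 + p - (k + 1) = n + p - k by omega, ← ih n (by omega),
        Finset.sum_congr rfl hpascal, Finset.sum_sub_distrib, Finset.sum_range_succ',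
        Finset.sum_range_succ'
          (fun l => (-1 : ℤ) ^ l * k.choose l * (n + 1 + p - l).choose (n + 1))]
      have hsplit : ∀ l ∈ Finset.range (k + 1),
          (-1 : ℤ) ^ (l + 1) * (k + 1).choose (l + 1) * (n + 1 + p - (l + 1)).choose (n + 1) =
            (-1 : ℤ) ^ (l + 1) * k.choose (l + 1) * (n + 1 + p - (l + 1)).choose (n + 1) -
              (-1 : ℤ) ^ l * k.choose l * (n + p - l).choose (n + 1) := by
        intro l _
        rw [show n + 1 + p - (l + 1) = n + p - l by omega, Nat.choose_succ_succ]
        push_cast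
        ring
      rw [Finset.sum_congr rfl hsplit, Finset.sum_sub_distrib, Finset.sum_range_succ
        (fun l => (-1 : ℤ) ^ (l + 1) * k.choose (l + 1) * (n + 1 + p - (l + 1)).choose (n + 1))]
      simp
      ring

/-- The Lanczos–Dyche coefficients are quotients of binomial coefficients. -/
theorem lanczosDyche_coeff_eq_choose_div {n l : ℕ} (hl : l ≤ n) :
    (Nat.factorial n * Nat.factorial (2 * n - l) : ℂ) /
        (Nat.factorial (2 * n) * Nat.factorial (n - l)) =
      (2 * n - l).choose n / (2 * n).choose n := by
  rw [Nat.cast_choose ℂ (show n ≤ 2 * n - l by omega), Nat.cast_choose ℂ (show n ≤ 2 * n by omega),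
    show 2 * n - l - n = n - l by omega, show 2 * n - n = n by omega]
  have h (m : ℕ) : (Nat.factorial m : ℂ) ≠ 0 := by exact_mod_cast m.factorial_ne_zero
  have := h n
  have := h (n - l)
  have := h (2 * n)
  field_simp

theorem iteratedDeriv_sum_mul_pow_div_factorial_zero (c : ℕ → ℂ) (n k : ℕ) :
    iteratedDeriv k (fun z : ℂ => ∑ l ∈ Finset.range (n + 1), c l * z ^ l / Nat.factorial l) 0 =
      if k ≤ n then c k else 0 := by
  rw [iteratedDeriv_fun_sum (fun l _ => by fun_prop)]
  have hterm (l : ℕ) : iteratedDeriv k (fun z : ℂ => c l * z ^ l / Nat.factorial l) 0 =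
      if k = l then c l else 0 := by
    rw [iteratedDeriv_div_const, iteratedDeriv_const_mul_field, iteratedDeriv_fun_pow_zero]
    have : (Nat.factorial l : ℂ) ≠ 0 := by exact_mod_cast l.factorial_ne_zero
    split_ifs <;> simp [this]
  simp [hterm]

/-- The increment function of the `n`-th Lanczos–Dyche method is the diagonal
`(n,n)` Padé approximant of the exponential: with
`Q_n(μ) = Σ_{l=0}^n C_{l,n} μ^l / l!`, `C_{l,n} = n!(2n-l)!/((2n)!(n-l)!)`, the
entire function `g(μ) = e^μ Q_n(-μ) - Q_n(μ)` vanishes to order `2n+1` at `0`: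
all its derivatives of order `k ≤ 2n` vanish at `0`. -/
theorem lanczos_dyche_pade (n : ℕ) (Q : ℂ → ℂ)
    (hQ : ∀ μ : ℂ, Q μ = ∑ l ∈ Finset.range (n + 1),
      ((Nat.factorial n * Nat.factorial (2 * n - l) : ℂ) /
          (Nat.factorial (2 * n) * Nat.factorial (n - l))) * μ ^ l / Nat.factorial l) :
    ∀ k ≤ 2 * n, iteratedDeriv k (fun μ : ℂ => Complex.exp μ * Q (-μ) - Q μ) 0 = 0 := by
  intro k hk
  set c : ℕ → ℂ := fun l => (2 * n - l).choose n / (2 * n).choose n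
  have hQc : Q = fun z => ∑ l ∈ Finset.range (n + 1), c l * z ^ l / Nat.factorial l := by
    funext z
    rw [hQ]
    refine Finset.sum_congr rfl fun l hl => ?_
    rw [lanczosDyche_coeff_eq_choose_div (by simpa [Nat.lt_succ_iff] using hl)]
  have hsmooth (m : ℕ) : ContDiff ℂ m Q := by
    rw [hQc]
    fun_prop
  have hderiv : ∀ l ≤ 2 * n, iteratedDeriv l Q 0 = c l := by
    intro l hl
    rw [hQc, iteratedDeriv_sum_mul_pow_div_factorial_zero, ite_eq_left_iff]
    intro hln
    simp [c, Nat.choose_eq_zero_of_lt (show 2 * n - l < n by omega)]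
  have hexp (m : ℕ) : iteratedDeriv m Complex.exp 0 = 1 := by
    simp [iteratedDeriv_eq_iterate]
  have hneg : ContDiff ℂ k (fun z => Q (-z)) := (hsmooth k).comp contDiff_neg
  have hcomm : (fun μ : ℂ => Complex.exp μ * Q (-μ) - Q μ) =
      fun μ => Q (-μ) * Complex.exp μ - Q μ := by
    funext μ
    ring
  rw [hcomm, iteratedDeriv_fun_sub (hneg.mul Complex.contDiff_exp).contDiffAt
    (hsmooth k).contDiffAt, iteratedDeriv_fun_mul hneg.contDiffAt Complex.contDiff_exp.contDiffAt,
    hderiv k hk, sub_eq_zero]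
  have hsum := congrArg (Int.cast : ℤ → ℂ)
    (alternating_sum_choose_mul_choose_sub k n n (by omega))
  push_cast at hsum
  simp only [← two_mul] at hsum
  simp only [c]
  rw [← hsum, Finset.sum_div]
  refine Finset.sum_congr rfl fun l hl => ?_
  have hlk : l ≤ k := by simpa [Nat.lt_succ_iff] using hl
  rw [hexp, iteratedDeriv_comp_neg, neg_zero, hderiv l (by omega), smul_eq_mul]
  simp only [c]
  ring
end

section
/- Let n ≥ 2 be an even natural number, let t1 < t2 be real numbers with Δt = t2 − t1, and let f : ℝ → ℝ be (n+2)-times continuously differentiable on [t1, t2]. Then there exists τ ∈ (t1, t2) such that ∫_{t1}^{t2} f(t) dt = Σ_{l=1}^{n} B_l (Δt^l / l!) [ f^{(l−1)}(t1) + (−1)^{l−1} f^{(l−1)}(t2) ] − B_{n+2} (Δt^{n+3} / (n+2)!) f^{(n+2)}(τ), where B_l are the Bernoulli numbers with the convention B_1 = 1/2. (Single-interval Euler–Maclaurin formula with remainder.) -/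
open MeasureTheory Set intervalIntegral

theorem bernoulliFun_one_eq_bernoulli' (k : ℕ) : bernoulliFun k 1 = bernoulli' k := by
  rw [bernoulliFun, Polynomial.eval_one_map, Polynomial.bernoulli_eval_one, eq_ratCast]

theorem bernoulliFun_zero_eq_neg_one_pow_mul_bernoulli' (k : ℕ) :
    bernoulliFun k 0 = (-1) ^ k * bernoulli' k := by
  rw [bernoulliFun_eval_zero, bernoulli]
  push_cast
  rfl

/-- On `[0, 1]`, an even-index Bernoulli polynomial is extremal at the endpoints. -/
theorem neg_one_pow_mul_bernoulliFun_le {k : ℕ} (hk : k ≠ 0) {x : ℝ} (hx : x ∈ Icc (0 : ℝ) 1) :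
    (-1) ^ (k + 1) * bernoulliFun (2 * k) x ≤ (-1) ^ (k + 1) * bernoulliFun (2 * k) 0 := by
  have h := hasSum_le (fun n : ℕ ↦ ?_) (hasSum_one_div_nat_pow_mul_cos hk hx)
    (hasSum_one_div_nat_pow_mul_cos hk (left_mem_Icc.mpr zero_le_one))
  · have hc : 0 < (2 * Real.pi) ^ (2 * k) / 2 / (2 * k).factorial := by positivity
    refine le_of_mul_le_mul_left ?_ hc
    simp only [bernoulliFun]
    convert h using 1 <;> ring
  · gcongr
    simpa using Real.cos_le_one _

theorem hasDerivWithinAt_iteratedDerivWithin_Icc {a b : ℝ} (hab : a < b) {f : ℝ → ℝ} {k : ℕ}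
    (hf : ContDiffOn ℝ (k + 1 : ℕ) f (Icc a b)) {x : ℝ} (hx : x ∈ Icc a b) :
    HasDerivWithinAt (iteratedDerivWithin k f (Icc a b))
      (iteratedDerivWithin (k + 1) f (Icc a b) x) (Icc a b) x := by
  rw [iteratedDerivWithin_succ]
  exact (hf.differentiableOn_iteratedDerivWithin (by exact_mod_cast k.lt_succ_self)
    (uniqueDiffOn_Icc hab) x hx).hasDerivWithinAt

theorem intervalIntegrable_iteratedDerivWithin_Icc {a b : ℝ} (hab : a < b) {f : ℝ → ℝ} {k : ℕ}
    (hf : ContDiffOn ℝ k f (Icc a b)) :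
    IntervalIntegrable (iteratedDerivWithin k f (Icc a b)) volume a b :=
  (hf.continuousOn_iteratedDerivWithin le_rfl
    (uniqueDiffOn_Icc hab)).intervalIntegrable_of_Icc hab.le

theorem hasDerivAt_bernoulliFun_rescaled {a b : ℝ} (hab : a < b) (k : ℕ) (x : ℝ) :
    HasDerivAt (fun t ↦ (b - a) / (k + 1) * bernoulliFun (k + 1) ((t - a) / (b - a)))
      (bernoulliFun k ((x - a) / (b - a))) x := by
  have hh : b - a ≠ 0 := (sub_pos.2 hab).ne'
  have hk : (k : ℝ) + 1 ≠ 0 := by positivity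
  convert! (((hasDerivAt_bernoulliFun (k + 1) ((x - a) / (b - a))).comp x
    (((hasDerivAt_id x).sub_const a).div_const (b - a))).const_mul
      ((b - a) / ((k : ℝ) + 1))) using 1
  push_cast
  field_simp

theorem continuous_bernoulliFun_rescaled (a b : ℝ) (k : ℕ) :
    Continuous fun t ↦ bernoulliFun k ((t - a) / (b - a)) :=
  (continuous_bernoulliFun k).comp (by fun_prop)

theorem integral_bernoulliFun_rescaled_eq_zero {a b : ℝ} (hab : a < b) {k : ℕ} (hk : k ≠ 0) :
    ∫ t in a..b, bernoulliFun k ((t - a) / (b - a)) = 0 := by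
  have hh : b - a ≠ 0 := (sub_pos.2 hab).ne'
  rw [integral_eq_sub_of_hasDerivAt (fun x _ ↦ hasDerivAt_bernoulliFun_rescaled hab k x)
    ((continuous_bernoulliFun_rescaled a b k).intervalIntegrable a b)]
  rw [div_self hh, sub_self, zero_div, bernoulliFun_endpoints_eq_of_ne_one (by omega), sub_self]

/-- The Euler–Maclaurin formula on a single interval, with the remainder in integral form. -/
theorem integral_eq_sum_bernoulli'_add_integral_bernoulliFun {a b : ℝ} (hab : a < b) {f : ℝ → ℝ}
    {k : ℕ} (hf : ContDiffOn ℝ k f (Icc a b)) :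
    ∫ t in a..b, f t =
      (∑ l ∈ Finset.Icc 1 k, (bernoulli' l : ℝ) * ((b - a) ^ l / l.factorial) *
        (iteratedDerivWithin (l - 1) f (Icc a b) a +
          (-1 : ℝ) ^ (l - 1) * iteratedDerivWithin (l - 1) f (Icc a b) b)) +
      (-1) ^ k * ((b - a) ^ k / k.factorial) *
        ∫ t in a..b, iteratedDerivWithin k f (Icc a b) t *
          bernoulliFun k ((t - a) / (b - a)) := by
  induction k with
  | zero => simp
  | succ k ih =>
    have hh : b - a ≠ 0 := (sub_pos.2 hab).ne'
    have hparts := integral_mul_deriv_eq_deriv_mul_of_hasDerivWithinAt (a := a) (b := b)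
      (u := iteratedDerivWithin k f (Icc a b))
      (fun x hx ↦ by
        rw [uIcc_of_le hab.le] at hx ⊢
        exact hasDerivWithinAt_iteratedDerivWithin_Icc hab hf hx)
      (fun x _ ↦ (hasDerivAt_bernoulliFun_rescaled hab k x).hasDerivWithinAt)
      (intervalIntegrable_iteratedDerivWithin_Icc hab hf)
      ((continuous_bernoulliFun_rescaled a b k).intervalIntegrable a b)
    simp only [mul_left_comm _ ((b - a) / ((k : ℝ) + 1))] at hparts
    rw [intervalIntegral.integral_const_mul, div_self hh, sub_self, zero_div,
      bernoulliFun_one_eq_bernoulli', bernoulliFun_zero_eq_neg_one_pow_mul_bernoulli'] at hparts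
    rw [ih (hf.of_le (by exact_mod_cast k.le_succ)), hparts,
      Finset.sum_Icc_succ_top (by omega), Nat.factorial_succ, Nat.add_sub_cancel]
    have hsq : ((-1 : ℝ) ^ k) * (-1) ^ k = 1 := by rw [← mul_pow]; simp
    have hk : (k : ℝ) + 1 ≠ 0 := by positivity
    have hkf : (k.factorial : ℝ) ≠ 0 := by positivity
    push_cast
    field_simp
    linear_combination ((bernoulli' (k + 1) : ℝ) * iteratedDerivWithin k f (Icc a b) a *
      (b - a) ^ (k + 1)) * hsq

/-- Mean value theorem for a continuous function integrated against the deviation of an even-index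
Bernoulli polynomial from its endpoint value. -/
theorem exists_integral_mul_bernoulliFun_sub {a b : ℝ} (hab : a < b) {g : ℝ → ℝ}
    (hg : ContinuousOn g (Icc a b)) {k : ℕ} (hk : k ≠ 0) :
    ∃ τ ∈ Ioo a b,
      ∫ t in a..b, g t * (bernoulliFun (2 * k) ((t - a) / (b - a)) - bernoulliFun (2 * k) 0) =
        -(bernoulliFun (2 * k) 0 * (b - a) * g τ) := by
  set w : ℝ → ℝ := fun t ↦ (-1) ^ (k + 1) *
    (bernoulliFun (2 * k) 0 - bernoulliFun (2 * k) ((t - a) / (b - a)))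
  have hh : 0 < b - a := sub_pos.2 hab
  have hB := continuous_bernoulliFun_rescaled a b (2 * k)
  have hw : Continuous w := by fun_prop
  have hw0 : ∀ t ∈ Ioo a b, 0 ≤ w t := fun t ht ↦ by
    have := neg_one_pow_mul_bernoulliFun_le hk (x := (t - a) / (b - a))
      ⟨div_nonneg (sub_nonneg.2 ht.1.le) hh.le, (div_le_one hh).2 (by linarith [ht.2])⟩
    simp only [w, mul_sub]
    linarith
  obtain ⟨τ, hτ, h⟩ := exists_eq_const_mul_setIntegral_of_nonneg (μ := volume)
    (isConnected_Ioo hab) measurableSet_Ioo (hg.mono Ioo_subset_Icc_self)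
    (hw.integrableOn_Icc.mono_set Ioo_subset_Icc_self)
    ((hg.mul hw.continuousOn).integrableOn_Icc.mono_set Ioo_subset_Icc_self) hw0
  refine ⟨τ, hτ, ?_⟩
  rw [← integral_Ioc_eq_integral_Ioo, ← integral_Ioc_eq_integral_Ioo,
    ← integral_of_le hab.le, ← integral_of_le hab.le] at h
  have hw_int : ∫ t in a..b, w t = (-1) ^ (k + 1) * (bernoulliFun (2 * k) 0 * (b - a)) := by
    rw [intervalIntegral.integral_const_mul, intervalIntegral.integral_sub (by simp)
      (hB.intervalIntegrable a b), integral_bernoulliFun_rescaled_eq_zero hab (by omega)]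
    simp [mul_comm]
  have hgw : (fun t ↦ g t * w t) = fun t ↦ -(-1) ^ (k + 1) *
      (g t * (bernoulliFun (2 * k) ((t - a) / (b - a)) - bernoulliFun (2 * k) 0)) := by
    ext t
    simp only [w]
    ring
  rw [hgw, intervalIntegral.integral_const_mul, hw_int] at h
  refine mul_left_cancel₀ (neg_ne_zero.2 (pow_ne_zero (k + 1) (neg_ne_zero.2 one_ne_zero))) ?_
  rw [h]
  ring


/-- Single-interval Euler–Maclaurin formula with remainder: for even `n ≥ 2`,
`t1 < t2` and `f` `(n+2)`-times continuously differentiable on `[t1, t2]`, there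
is `τ ∈ (t1, t2)` with
`∫_{t1}^{t2} f = Σ_{l=1}^n B_l (Δt^l/l!) [f^{(l-1)}(t1) + (-1)^{l-1} f^{(l-1)}(t2)]
  - B_{n+2} (Δt^{n+3}/(n+2)!) f^{(n+2)}(τ)`,
where `B_l` are the Bernoulli numbers with the convention `B_1 = 1/2`
(Mathlib's `bernoulli'`). -/
theorem euler_maclaurin_single_interval (n : ℕ) (hn : 2 ≤ n) (hne : Even n)
    (t1 t2 : ℝ) (h12 : t1 < t2)
    (f : ℝ → ℝ) (hf : ContDiffOn ℝ (n + 2) f (Set.Icc t1 t2)) :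
    ∃ τ ∈ Set.Ioo t1 t2,
      ∫ t in t1..t2, f t =
        (∑ l ∈ Finset.Icc 1 n,
          ((bernoulli' l : ℚ) : ℝ) * ((t2 - t1) ^ l / Nat.factorial l) *
            (iteratedDerivWithin (l - 1) f (Set.Icc t1 t2) t1 +
              (-1 : ℝ) ^ (l - 1) * iteratedDerivWithin (l - 1) f (Set.Icc t1 t2) t2))
        - ((bernoulli' (n + 2) : ℚ) : ℝ) * ((t2 - t1) ^ (n + 3) / Nat.factorial (n + 2)) *
            iteratedDerivWithin (n + 2) f (Set.Icc t1 t2) τ := by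
  obtain ⟨m, rfl⟩ := hne
  have hf' : ContDiffOn ℝ ((m + m + 2 : ℕ) : WithTop ℕ∞) f (Icc t1 t2) := by exact_mod_cast hf
  have hg := hf'.continuousOn_iteratedDerivWithin le_rfl (uniqueDiffOn_Icc h12)
  have hgi := intervalIntegrable_iteratedDerivWithin_Icc h12 hf'
  have hB := continuous_bernoulliFun_rescaled t1 t2 (m + m + 2)
  obtain ⟨τ, hτ, h⟩ := exists_integral_mul_bernoulliFun_sub h12 hg m.succ_ne_zero
  rw [show 2 * m.succ = m + m + 2 by omega] at h
  refine ⟨τ, hτ, ?_⟩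
  have hftc : ∫ t in t1..t2, iteratedDerivWithin (m + m + 2) f (Icc t1 t2) t =
      iteratedDerivWithin (m + m + 1) f (Icc t1 t2) t2 -
        iteratedDerivWithin (m + m + 1) f (Icc t1 t2) t1 := by
    refine integral_eq_sub_of_hasDerivAt_of_le h12.le
      (fun x hx ↦ (hasDerivWithinAt_iteratedDerivWithin_Icc h12 hf' hx).continuousWithinAt)
      (fun x hx ↦ (hasDerivWithinAt_iteratedDerivWithin_Icc h12 hf'
        (Ioo_subset_Icc_self hx)).hasDerivAt (Icc_mem_nhds hx.1 hx.2)) hgi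
  have heven : Even (m + m + 2) := ⟨m + 1, by ring⟩
  have hodd : (-1 : ℝ) ^ (m + m + 1) = -1 := Odd.neg_one_pow ⟨m, by ring⟩
  simp only [mul_sub] at h
  rw [intervalIntegral.integral_sub (hgi.mul_continuousOn hB.continuousOn) (hgi.mul_const _),
    intervalIntegral.integral_mul_const, hftc, bernoulliFun_zero_eq_neg_one_pow_mul_bernoulli',
    heven.neg_one_pow, one_mul] at h
  rw [integral_eq_sum_bernoulli'_add_integral_bernoulliFun h12 hf',
    Finset.sum_Icc_succ_top (by omega), Finset.sum_Icc_succ_top (by omega),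
    bernoulli'_eq_zero_of_odd (n := m + m + 1) ⟨m, by ring⟩ (by omega), heven.neg_one_pow]
  simp only [Nat.add_sub_cancel, show m + m + 2 - 1 = m + m + 1 by omega,
    show m + m + 1 + 1 = m + m + 2 by omega, hodd]
  push_cast
  linear_combination ((t2 - t1) ^ (m + m + 2) / ((m + m + 2).factorial : ℝ)) * h
end

section
/- Let V : ℝ → ℝ be a function whose derivative V' exists and is differentiable everywhere, let Δt be a real number, and let Q, P : ℝ² → ℝ be differentiable functions satisfying, for all (q, p) ∈ ℝ², the trapezoidal (second-order Lanczos–Dyche) scheme: Q(q,p) + (Δt²/4)·V'(Q(q,p)) = q − (Δt²/4)·V'(q) + Δt·p and P(q,p) = p − (Δt/2)·(V'(q) + V'(Q(q,p))). Then at every point (q, p) where 1 + (Δt²/4)·V''(Q(q,p)) ≠ 0, the Jacobian determinant of the map (q,p) ↦ (Q(q,p), P(q,p)) equals (1 + (Δt²/4)·V''(q)) / (1 + (Δt²/4)·V''(Q(q,p))). In particular the scheme is symplectic exactly when V''(q) = V''(Q(q,p)), e.g. when V is at most quadratic. -/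
/-- The determinant of an endomorphism of `R × R` in terms of the coordinates of the images of
`(1, 0)` and `(0, 1)`. -/
theorem LinearMap.det_prod_self {R : Type*} [CommRing R] (f : R × R →ₗ[R] R × R) :
    LinearMap.det f = (f (1, 0)).1 * (f (0, 1)).2 - (f (0, 1)).1 * (f (1, 0)).2 := by
  rw [← LinearMap.det_toMatrix (Module.Basis.finTwoProd R), Matrix.det_fin_two]
  simp [LinearMap.toMatrix_apply]

/-- Jacobian of the trapezoidal (second-order Lanczos–Dyche) scheme for
`H(q,p) = p²/2 + V(q)`: if the differentiable maps `Q, P : ℝ² → ℝ` satisfy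
`Q + (Δt²/4)V'(Q) = q - (Δt²/4)V'(q) + Δt·p` and
`P = p - (Δt/2)(V'(q) + V'(Q))`, then wherever `1 + (Δt²/4)V''(Q(q,p)) ≠ 0` the
Jacobian determinant of `(q,p) ↦ (Q(q,p), P(q,p))` equals
`(1 + (Δt²/4)V''(q)) / (1 + (Δt²/4)V''(Q(q,p)))`; in particular the scheme is
symplectic exactly when `V''(q) = V''(Q(q,p))`, e.g. when `V` is at most
quadratic. -/
theorem trapezoidal_scheme_jacobian (V : ℝ → ℝ) (hV : Differentiable ℝ V)
    (hV' : Differentiable ℝ (deriv V)) (Δt : ℝ)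
    (Q P : ℝ × ℝ → ℝ) (hQd : Differentiable ℝ Q) (hPd : Differentiable ℝ P)
    (hQ : ∀ x : ℝ × ℝ,
      Q x + Δt ^ 2 / 4 * deriv V (Q x) = x.1 - Δt ^ 2 / 4 * deriv V x.1 + Δt * x.2)
    (hP : ∀ x : ℝ × ℝ, P x = x.2 - Δt / 2 * (deriv V x.1 + deriv V (Q x))) :
    ∀ x : ℝ × ℝ, 1 + Δt ^ 2 / 4 * deriv (deriv V) (Q x) ≠ 0 →
      LinearMap.det ((fderiv ℝ (fun y : ℝ × ℝ => (Q y, P y)) x).toLinearMap) =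
        (1 + Δt ^ 2 / 4 * deriv (deriv V) x.1) /
          (1 + Δt ^ 2 / 4 * deriv (deriv V) (Q x)) := by
  intro x hD
  have hQf : HasFDerivAt Q (fderiv ℝ Q x) x := (hQd x).hasFDerivAt
  have hPf : HasFDerivAt P (fderiv ℝ P x) x := (hPd x).hasFDerivAt
  have hfst : HasFDerivAt (fun y : ℝ × ℝ => y.1) (ContinuousLinearMap.fst ℝ ℝ ℝ) x :=
    hasFDerivAt_fst
  have hsnd : HasFDerivAt (fun y : ℝ × ℝ => y.2) (ContinuousLinearMap.snd ℝ ℝ ℝ) x :=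
    hasFDerivAt_snd
  have hVQ := (hV' (Q x)).hasDerivAt.comp_hasFDerivAt x hQf
  have hVq := (hV' x.1).hasDerivAt.comp_hasFDerivAt x hfst
  have implicit_deriv := (hQf.add (hVQ.const_mul (Δt ^ 2 / 4))).unique
    (((hfst.sub (hVq.const_mul (Δt ^ 2 / 4))).add (hsnd.const_mul Δt)).congr_of_eventuallyEq
      (Filter.Eventually.of_forall hQ))
  have explicit_deriv := hPf.unique
    ((hsnd.sub ((hVq.add hVQ).const_mul (Δt / 2))).congr_of_eventuallyEq
      (Filter.Eventually.of_forall hP))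
  have hQ₁ := DFunLike.congr_fun implicit_deriv (1, 0)
  have hQ₂ := DFunLike.congr_fun implicit_deriv (0, 1)
  have hP₁ := DFunLike.congr_fun explicit_deriv (1, 0)
  have hP₂ := DFunLike.congr_fun explicit_deriv (0, 1)
  simp only [add_apply, sub_apply, smul_apply, smul_eq_mul, ContinuousLinearMap.coe_fst',
    ContinuousLinearMap.coe_snd'] at hQ₁ hQ₂ hP₁ hP₂
  rw [(hQf.prodMk hPf).fderiv, LinearMap.det_prod_self, eq_div_iff hD]
  simp only [ContinuousLinearMap.coe_coe, ContinuousLinearMap.prod_apply]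
  rw [hP₁, hP₂]
  linear_combination hQ₁ + Δt / 2 * deriv (deriv V) x.1 * hQ₂
end

section
/- Let γ be a real number and let q, p : ℝ → ℝ be differentiable functions satisfying Hamilton's equations of the damped harmonic oscillator: q̇(t) = e^{−γt} p(t) and ṗ(t) = −e^{γt} q(t) for all t. Then the quantity C(t) = (p(t)²/2)·e^{−γt} + (γ/2)·p(t)·q(t) + (q(t)²/2)·e^{γt} is a constant of the motion: C(s) = C(t) for all real s, t. -/
/-- For the damped harmonic oscillator in Hamiltonian form,
`q̇ = e^{-γt} p`, `ṗ = -e^{γt} q`, the quantity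
`C(t) = (p²/2)e^{-γt} + (γ/2)pq + (q²/2)e^{γt}` is a constant of the motion. -/
theorem damped_oscillator_invariant (γ : ℝ) (q p : ℝ → ℝ)
    (hq : Differentiable ℝ q) (hp : Differentiable ℝ p)
    (hq' : ∀ t, deriv q t = Real.exp (-γ * t) * p t)
    (hp' : ∀ t, deriv p t = -Real.exp (γ * t) * q t) :
    ∀ s t : ℝ,
      p s ^ 2 / 2 * Real.exp (-γ * s) + γ / 2 * p s * q s + q s ^ 2 / 2 * Real.exp (γ * s) =
      p t ^ 2 / 2 * Real.exp (-γ * t) + γ / 2 * p t * q t + q t ^ 2 / 2 * Real.exp (γ * t) := by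
  refine is_const_of_deriv_eq_zero (f := fun t ↦ p t ^ 2 / 2 * Real.exp (-γ * t) +
    γ / 2 * p t * q t + q t ^ 2 / 2 * Real.exp (γ * t)) (by fun_prop) fun t ↦ ?_
  have hqt : HasDerivAt q (Real.exp (-γ * t) * p t) t := hq' t ▸ (hq t).hasDerivAt
  have hpt : HasDerivAt p (-Real.exp (γ * t) * q t) t := hp' t ▸ (hp t).hasDerivAt
  have hexp (c : ℝ) : HasDerivAt (fun t ↦ Real.exp (c * t)) (Real.exp (c * t) * (c * 1)) t :=
    ((hasDerivAt_id t).const_mul c).exp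
  refine (((((hpt.pow 2).div_const 2).mul (hexp (-γ))).add
    ((hpt.const_mul (γ / 2)).mul hqt)).add
    (((hqt.pow 2).div_const 2).mul (hexp γ))).deriv.trans ?_
  simp only [Pi.pow_apply]
  ring
end
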